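/- Define for A > 0 the ratio R(A) := (∫₀^A t/(√(A−t)·(1+t²)^{5/4}) dt) / (2·∫₀^A 1/(√(A−t)·(1+t²)^{5/4}) dt). Then R(A) ≤ A/2 for every A > 0, and lim_{A→∞} R(A) = (1/3)·Γ(7/4)·Γ(1/4)/(Γ(3/4)²·Γ(3/2)), where Γ denotes the Gamma function. In particular sup_{A>0} R(A) is finite. -/

import Mathlib

open MeasureTheory Set Topology Filter

noncomputable section

/-- A function of class `W^{2,2}(0,1)`, identified with its `C¹([0,1])` representative:
`u` has weak derivatives `du`, `ddu` (encoded through the fundamental theorem of calculus)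
with `du, ddu ∈ L¹(0,1)` and `ddu ∈ L²(0,1)`. -/
structure W22 where
  u : ℝ → ℝ
  du : ℝ → ℝ
  ddu : ℝ → ℝ
  du_int : IntegrableOn du (Icc (0:ℝ) 1)
  ddu_int : IntegrableOn ddu (Icc (0:ℝ) 1)
  ddu_sq : IntegrableOn (fun x => (ddu x)^2) (Icc (0:ℝ) 1)
  ftc_u : ∀ x ∈ Icc (0:ℝ) 1, u x = u 0 + ∫ s in (0:ℝ)..x, du s
  ftc_du : ∀ x ∈ Icc (0:ℝ) 1, du x = du 0 + ∫ s in (0:ℝ)..x, ddu s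

/-- The elastic energy of a graph. -/
def graphE (f : W22) : ℝ :=
  ∫ x in Ioo (0:ℝ) 1, (f.ddu x)^2 / (1 + (f.du x)^2) ^ ((5:ℝ)/2)

/-- The length of a graph. -/
def graphLen (f : W22) : ℝ :=
  ∫ x in Ioo (0:ℝ) 1, Real.sqrt (1 + (f.du x)^2)

/-- The length-penalized elastic energy of a graph. -/
def graphPE (ε : ℝ) (f : W22) : ℝ := graphE f + ε * graphLen f

/-- Membership in the admissible class `G_ψ`. -/
def MemG (ψ : ℝ → ℝ) (f : W22) : Prop :=
  f.u 0 = 0 ∧ f.u 1 = 0 ∧ ∀ x ∈ Icc (0:ℝ) 1, ψ x ≤ f.u x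

/-- An admissible obstacle. -/
structure Admissible (ψ : ℝ → ℝ) : Prop where
  cont : ContinuousOn ψ (Icc 0 1)
  neg0 : ψ 0 < 0
  neg1 : ψ 1 < 0
  pos : ∃ x ∈ Icc (0:ℝ) 1, 0 < ψ x
  osd : ∃ C : ℝ, ∀ x ∈ Ioo (0:ℝ) 1,
      (∃ d : ℝ, |d| ≤ C ∧ HasDerivWithinAt ψ d (Ici x) x) ∧
      (∃ d : ℝ, |d| ≤ C ∧ HasDerivWithinAt ψ d (Iic x) x)

/-- `‖ψ'‖_∞`, the smallest uniform bound for the one-sided derivatives of `ψ` on `(0,1)`. -/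
def obstNorm (ψ : ℝ → ℝ) : ℝ :=
  sInf {C : ℝ | 0 ≤ C ∧ ∀ x ∈ Ioo (0:ℝ) 1, ∀ d : ℝ,
    (HasDerivWithinAt ψ d (Ici x) x ∨ HasDerivWithinAt ψ d (Iic x) x) → |d| ≤ C}

/-- A planar curve on `(0,1)` of class `W^{1,1}((0,1);ℝ²)`. -/
structure Curve1 where
  x : ℝ → ℝ
  y : ℝ → ℝ
  dx : ℝ → ℝ
  dy : ℝ → ℝ
  dx_int : IntegrableOn dx (Icc (0:ℝ) 1)
  dy_int : IntegrableOn dy (Icc (0:ℝ) 1)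
  ftc_x : ∀ t ∈ Icc (0:ℝ) 1, x t = x 0 + ∫ s in (0:ℝ)..t, dx s
  ftc_y : ∀ t ∈ Icc (0:ℝ) 1, y t = y 0 + ∫ s in (0:ℝ)..t, dy s

/-- A planar curve of class `W^{1,1}((0,1);ℝ²) ∩ W^{2,1}_loc((0,1);ℝ²)`. -/
structure Curve extends Curve1 where
  ddx : ℝ → ℝ
  ddy : ℝ → ℝ
  ddx_loc : ∀ a b : ℝ, 0 < a → b < 1 → IntegrableOn ddx (Icc a b)
  ddy_loc : ∀ a b : ℝ, 0 < a → b < 1 → IntegrableOn ddy (Icc a b)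
  ftc_dx : ∀ a ∈ Ioo (0:ℝ) 1, ∀ t ∈ Ioo (0:ℝ) 1, dx t = dx a + ∫ s in a..t, ddx s
  ftc_dy : ∀ a ∈ Ioo (0:ℝ) 1, ∀ t ∈ Ioo (0:ℝ) 1, dy t = dy a + ∫ s in a..t, ddy s

/-- `|γ'(t)|`. -/
def speed1 (γ : Curve1) (t : ℝ) : ℝ := Real.sqrt ((γ.dx t)^2 + (γ.dy t)^2)

/-- The length `L(γ) = ∫₀¹ |γ'| dt`, as an extended real number. -/
def len1E (γ : Curve1) : ENNReal := ∫⁻ t in Ioo (0:ℝ) 1, ENNReal.ofReal (speed1 γ t)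

/-- The length `L(γ)`, as a real number. -/
def len1 (γ : Curve1) : ℝ := ∫ t in Ioo (0:ℝ) 1, speed1 γ t

def lenE (γ : Curve) : ENNReal := len1E γ.toCurve1

/-- The integrand `⟨γ'', N_γ⟩²/|γ'|³` of the elastic energy. -/
def elInt (γ : Curve) (t : ℝ) : ℝ :=
  (γ.dx t * γ.ddy t - γ.dy t * γ.ddx t)^2 / ((γ.dx t)^2 + (γ.dy t)^2) ^ ((5:ℝ)/2)

/-- Elastic energy of a curve, as an extended real number. -/
def elE (γ : Curve) : ENNReal := ∫⁻ t in Ioo (0:ℝ) 1, ENNReal.ofReal (elInt γ t)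

/-- The length-penalized elastic energy `E_ε = E + ε·L`. -/
def penE (ε : ℝ) (γ : Curve) : ENNReal := elE γ + ENNReal.ofReal ε * lenE γ

/-- A curve is immersed if `|γ'| > ε` on `(0,1)` for some `ε > 0`. -/
def Curve.Immersed (γ : Curve) : Prop :=
  ∃ ε > 0, ∀ t ∈ Ioo (0:ℝ) 1, ε < speed1 γ.toCurve1 t

/-- `u` lies in `W^{2,2}_loc(c,d)` with weak derivatives `du`, `ddu`. -/
structure W22locOn (u du ddu : ℝ → ℝ) (c d : ℝ) : Prop where
  du_loc : ∀ a b : ℝ, c < a → b < d → IntegrableOn du (Icc a b)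
  ddu_loc : ∀ a b : ℝ, c < a → b < d → IntegrableOn ddu (Icc a b)
  ddu_sq : ∀ a b : ℝ, c < a → b < d → IntegrableOn (fun t => (ddu t)^2) (Icc a b)
  ftc_u : ∀ a ∈ Ioo c d, ∀ t ∈ Ioo c d, u t = u a + ∫ s in a..t, du s
  ftc_du : ∀ a ∈ Ioo c d, ∀ t ∈ Ioo c d, du t = du a + ∫ s in a..t, ddu s

/-- `γ` is a pseudograph. -/
def Pseudograph (γ : Curve) : Prop :=
  γ.Immersed ∧ (∀ t ∈ Ioo (0:ℝ) 1, 0 ≤ γ.dx t) ∧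
  ∀ a b : ℝ, 0 ≤ a → a < b → b ≤ 1 → (∀ t ∈ Ioo a b, 0 < γ.dx t) →
    ∃ u du ddu : ℝ → ℝ, W22locOn u du ddu (γ.x a) (γ.x b) ∧
      ∀ t ∈ Ioo a b, u (γ.x t) = γ.y t

/-- Membership in `P_ψ`. -/
def MemP (ψ : ℝ → ℝ) (γ : Curve) : Prop :=
  Pseudograph γ ∧ γ.x 0 = 0 ∧ γ.y 0 = 0 ∧ γ.x 1 = 1 ∧ γ.y 1 = 0 ∧
  ∀ t ∈ Icc (0:ℝ) 1, ψ (γ.x t) ≤ γ.y t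

/-- `v : (a,b) → (c,d)` is invertible in `W^{1,1}` (increasing case): it has an
inverse `w` which is again of class `W^{1,1}`. -/
def InvertibleW11On (v : ℝ → ℝ) (a b c d : ℝ) : Prop :=
  ∃ w dw : ℝ → ℝ, IntegrableOn dw (Icc c d) ∧
    (∀ s ∈ Icc c d, w s = w c + ∫ r in c..s, dw r) ∧
    (∀ t ∈ Ioo a b, v t ∈ Ioo c d ∧ w (v t) = t) ∧
    (∀ s ∈ Ioo c d, w s ∈ Ioo a b ∧ v (w s) = s)

/-- `γ ∈ M_{γ₀}`: a `∩`-shaped curve above `γ₀` with parameters `β₁, β₂` and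
graph reparametrization `u`. -/
structure CapAbove (γ : Curve1) (γ₀ : Curve) (β₁ β₂ : ℝ) (u : ℝ → ℝ) : Prop where
  ep0 : γ.x 0 = 0 ∧ γ.y 0 = 0
  ep1 : γ.x 1 = 1 ∧ γ.y 1 = 0
  hβ : 0 ≤ β₁ ∧ β₁ < β₂ ∧ β₂ ≤ 1
  left : ∀ t ∈ Icc (0:ℝ) β₁, γ.x t = 0
  right : ∀ t ∈ Icc β₂ (1:ℝ), γ.x t = 1
  inv : InvertibleW11On γ.x β₁ β₂ 0 1
  graph : ∀ t ∈ Ioo β₁ β₂, u (γ.x t) = γ.y t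
  ucont : ContinuousOn u (Icc (0:ℝ) 1)
  above : ∀ t ∈ Icc (0:ℝ) 1, γ₀.y t ≤ u (γ₀.x t)

/-- A `∩`-shaped pseudograph with parameters `β₁, β₂` and graph reparametrization `u`
(with weak derivatives `du`, `ddu`). -/
structure CapShaped (γ : Curve) (β₁ β₂ : ℝ) (u du ddu : ℝ → ℝ) : Prop where
  hβ : 0 ≤ β₁ ∧ β₁ < β₂ ∧ β₂ ≤ 1
  left : ∀ t ∈ Icc (0:ℝ) β₁, γ.x t = 0
  right : ∀ t ∈ Icc β₂ (1:ℝ), γ.x t = 1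
  pos : ∀ t ∈ Ioo β₁ β₂, 0 < γ.dx t
  graph : ∀ t ∈ Ioo β₁ β₂, u (γ.x t) = γ.y t
  reg : W22locOn u du ddu 0 1

/-- `G(x) = ∫₀ˣ (1+s²)^{-5/4} ds`. -/
def Gfun (x : ℝ) : ℝ := ∫ s in (0:ℝ)..x, ((1 + s^2) ^ (-(5:ℝ)/4) : ℝ)

/-- `c₀ = ∫_ℝ (1+s²)^{-5/4} ds`. -/
def c0 : ℝ := ∫ s : ℝ, ((1 + s^2) ^ (-(5:ℝ)/4) : ℝ)

/-- The inverse of `G`. -/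
def Ginv : ℝ → ℝ := Function.invFun Gfun

/-- The ratio `R(B)` from the nonexistence theorem. -/
def ratio (B : ℝ) : ℝ :=
  (∫ t in (0:ℝ)..B, t / (Real.sqrt (B - t) * (1 + t^2) ^ ((5:ℝ)/4))) /
  (2 * ∫ t in (0:ℝ)..B, 1 / (Real.sqrt (B - t) * (1 + t^2) ^ ((5:ℝ)/4)))

/-- The symmetric cone obstacle with valley `[0,s]` and peak `A`. -/
def coneObstacle (A s : ℝ) : ℝ → ℝ := fun x =>
  if x ≤ 1/2 then A / (1/2 - s) * (x - s) else A / (1/2 - s) * (1 - s - x)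

lemma intervalIntegrable_one_div_sqrt_sub (A a b : ℝ) (hab : a ≤ b) (hb : b ≤ A) :
    IntervalIntegrable (fun t => 1 / Real.sqrt (A - t)) volume a b := by
  have h : IntervalIntegrable (fun t : ℝ => (A - t) ^ (-(1/2) : ℝ)) volume a b := by
    have := (intervalIntegral.intervalIntegrable_rpow' (a := A - a) (b := A - b)
      (r := (-(1/2) : ℝ)) (by norm_num)).comp_sub_left A
    simpa using this
  refine h.congr fun t ht => ?_
  rw [uIoc_of_le hab] at ht
  have : 0 ≤ A - t := by linarith [ht.2]
  simp only [Real.rpow_neg this, Real.sqrt_eq_rpow, one_div]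

lemma integral_one_div_sqrt_sub (A a : ℝ) (ha : a ≤ A) :
    ∫ t in a..A, 1 / Real.sqrt (A - t) = 2 * Real.sqrt (A - a) := by
  have h : ∫ t in a..A, 1 / Real.sqrt (A - t) = ∫ t in a..A, (A - t) ^ (-(1/2) : ℝ) := by
    refine intervalIntegral.integral_congr fun t ht => ?_
    rw [uIcc_of_le ha] at ht
    have : 0 ≤ A - t := by linarith [ht.2]
    simp only [Real.rpow_neg this, Real.sqrt_eq_rpow, one_div]
  rw [h, intervalIntegral.integral_comp_sub_left (fun x : ℝ => x ^ (-(1/2) : ℝ)) A,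
    integral_rpow (Or.inl (by norm_num)), Real.sqrt_eq_rpow]
  norm_num
  ring

lemma intervalIntegrable_div_sqrt_sub {f : ℝ → ℝ} (hf : Continuous f) (A a b : ℝ)
    (hab : a ≤ b) (hb : b ≤ A) :
    IntervalIntegrable (fun t => f t / Real.sqrt (A - t)) volume a b := by
  have := (intervalIntegrable_one_div_sqrt_sub A a b hab hb).continuousOn_mul
    hf.continuousOn
  simpa only [mul_one_div] using this

lemma tendsto_sqrt_mul_integral_half {f : ℝ → ℝ} (hf : Continuous f)
    (hint : IntegrableOn f (Ioi 0)) :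
    Tendsto (fun A => Real.sqrt A * ∫ t in (0:ℝ)..A / 2, f t / Real.sqrt (A - t)) atTop
      (𝓝 (∫ t in Ioi 0, f t)) := by
  have key : Tendsto (fun A : ℝ => ∫ t in Ioi (0:ℝ),
      (Iic (A / 2)).indicator (fun t => Real.sqrt A * (f t / Real.sqrt (A - t))) t) atTop
      (𝓝 (∫ t in Ioi 0, f t)) := by
    refine tendsto_integral_filter_of_dominated_convergence (fun t => Real.sqrt 2 * ‖f t‖)
      ?_ ?_ (hint.norm.const_mul _) ?_
    · refine Eventually.of_forall fun A => Measurable.aestronglyMeasurable ?_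
      refine Measurable.indicator ?_ measurableSet_Iic
      have := hf.measurable
      fun_prop
    · filter_upwards [eventually_gt_atTop 0] with A hA
      refine Eventually.of_forall fun t => ?_
      by_cases ht : t ∈ Iic (A / 2)
      · rw [indicator_of_mem ht]
        have ht' : t ≤ A / 2 := ht
        have hpos : 0 < Real.sqrt (A - t) := Real.sqrt_pos.2 (by linarith)
        rw [norm_mul, norm_div, Real.norm_of_nonneg (Real.sqrt_nonneg _),
          Real.norm_of_nonneg (Real.sqrt_nonneg _), ← mul_div_assoc, div_le_iff₀ hpos]
        have h2 : Real.sqrt A ≤ Real.sqrt 2 * Real.sqrt (A - t) := by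
          rw [← Real.sqrt_mul (by norm_num)]
          exact Real.sqrt_le_sqrt (by linarith)
        nlinarith [norm_nonneg (f t)]
      · rw [indicator_of_notMem ht]
        simp only [norm_zero]
        positivity
    · refine Eventually.of_forall fun t => ?_
      have h1 : Tendsto (fun A : ℝ => Real.sqrt (1 + t / (A - t)) * f t) atTop
          (𝓝 (f t)) := by
        have h0 : Tendsto (fun A : ℝ => t / (A - t)) atTop (𝓝 0) :=
          (tendsto_atTop_add_const_right _ (-t) tendsto_id).const_div_atTop t
        have := ((h0.const_add 1).sqrt).mul_const (f t)
        simpa using this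
      refine h1.congr' ?_
      filter_upwards [eventually_ge_atTop (2 * t), eventually_gt_atTop t,
        eventually_gt_atTop 0] with A h2 h3 h4
      have hpos : 0 < A - t := by linarith
      rw [indicator_of_mem (show t ∈ Iic (A / 2) by simp only [mem_Iic]; linarith)]
      have : 1 + t / (A - t) = A / (A - t) := by field_simp; ring
      rw [this, Real.sqrt_div h4.le]
      ring
  refine key.congr' ?_
  filter_upwards [eventually_gt_atTop 0] with A hA
  rw [setIntegral_indicator measurableSet_Iic, Ioi_inter_Iic,
    ← intervalIntegral.integral_of_le (by linarith), intervalIntegral.integral_const_mul]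

lemma tendsto_sqrt_mul_integral_tail {f : ℝ → ℝ}
    (hb : ∀ t, 0 < t → |f t| * (t * Real.sqrt t) ≤ 1) :
    Tendsto (fun A => Real.sqrt A * ∫ t in (A / 2)..A, f t / Real.sqrt (A - t)) atTop
      (𝓝 0) := by
  have hlim : Tendsto (fun A : ℝ => 4 / Real.sqrt A) atTop (𝓝 0) :=
    Real.tendsto_sqrt_atTop.const_div_atTop 4
  refine squeeze_zero_norm' ?_ hlim
  filter_upwards [eventually_gt_atTop 0] with A hA
  have hA2 : 0 < A / 2 := by linarith
  have hs : 0 < Real.sqrt (A / 2) := Real.sqrt_pos.2 hA2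
  have hsA : 0 < Real.sqrt A := Real.sqrt_pos.2 hA
  have hbd : ‖∫ t in (A / 2)..A, f t / Real.sqrt (A - t)‖ ≤
      ∫ t in (A / 2)..A, (1 / (A / 2 * Real.sqrt (A / 2))) * (1 / Real.sqrt (A - t)) := by
    refine intervalIntegral.norm_integral_le_of_norm_le (by linarith) ?_
      ((intervalIntegrable_one_div_sqrt_sub A _ _ (by linarith) le_rfl).const_mul _)
    refine Eventually.of_forall fun t ht => ?_
    rw [norm_div, Real.norm_of_nonneg (Real.sqrt_nonneg _), div_eq_mul_one_div]
    refine mul_le_mul_of_nonneg_right ?_ (by positivity)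
    rw [le_div_iff₀ (by positivity)]
    have hmono : A / 2 * Real.sqrt (A / 2) ≤ t * Real.sqrt t :=
      mul_le_mul ht.1.le (Real.sqrt_le_sqrt ht.1.le) hs.le (by linarith [ht.1])
    exact (mul_le_mul_of_nonneg_left hmono (abs_nonneg _)).trans (hb t (by linarith [ht.1]))
  rw [intervalIntegral.integral_const_mul, integral_one_div_sqrt_sub A _ (by linarith),
    show A - A / 2 = A / 2 by ring] at hbd
  rw [norm_mul, Real.norm_of_nonneg hsA.le]
  calc _ ≤ Real.sqrt A * (1 / (A / 2 * Real.sqrt (A / 2)) * (2 * Real.sqrt (A / 2))) := by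
        gcongr
    _ = 4 / Real.sqrt A := by
        field_simp
        rw [Real.sq_sqrt hA.le]
        ring

lemma tendsto_sqrt_mul_integral_div_sqrt_sub {f : ℝ → ℝ} (hf : Continuous f)
    (hint : IntegrableOn f (Ioi 0)) (hb : ∀ t, 0 < t → |f t| * (t * Real.sqrt t) ≤ 1) :
    Tendsto (fun A => Real.sqrt A * ∫ t in (0:ℝ)..A, f t / Real.sqrt (A - t)) atTop
      (𝓝 (∫ t in Ioi 0, f t)) := by
  have h := (tendsto_sqrt_mul_integral_half hf hint).add (tendsto_sqrt_mul_integral_tail hb)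
  rw [add_zero] at h
  refine h.congr' ?_
  filter_upwards [eventually_gt_atTop 0] with A hA
  rw [← mul_add, intervalIntegral.integral_add_adjacent_intervals
    (intervalIntegrable_div_sqrt_sub hf A _ _ (by linarith) (by linarith))
    (intervalIntegrable_div_sqrt_sub hf A _ _ (by linarith) le_rfl)]

lemma continuous_one_add_sq_rpow (r : ℝ) : Continuous fun t : ℝ => (1 + t ^ 2) ^ r :=
  (by fun_prop : Continuous fun t : ℝ => 1 + t ^ 2).rpow_const
    fun t => Or.inl (by positivity)

lemma mul_sqrt_le_one_add_sq_rpow {t : ℝ} (ht : 0 < t) :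
    t * Real.sqrt t ≤ (1 + t ^ 2) ^ ((5:ℝ) / 4) := by
  have h : t * Real.sqrt t = (t ^ 2) ^ ((3:ℝ) / 4) := by
    rw [Real.sqrt_eq_rpow, ← Real.rpow_natCast, ← Real.rpow_mul ht.le,
      ← Real.rpow_one_add' ht.le (by norm_num)]
    norm_num
  calc t * Real.sqrt t = (t ^ 2) ^ ((3:ℝ) / 4) := h
    _ ≤ (1 + t ^ 2) ^ ((3:ℝ) / 4) :=
        Real.rpow_le_rpow (by positivity) (by linarith) (by norm_num)
    _ ≤ (1 + t ^ 2) ^ ((5:ℝ) / 4) :=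
        Real.rpow_le_rpow_of_exponent_le (by nlinarith) (by norm_num)

lemma mul_mul_sqrt_le_one_add_sq_rpow {t : ℝ} (ht : 0 < t) :
    t * (t * Real.sqrt t) ≤ (1 + t ^ 2) ^ ((5:ℝ) / 4) := by
  have h : t * (t * Real.sqrt t) = (t ^ 2) ^ ((5:ℝ) / 4) := by
    rw [Real.sqrt_eq_rpow, ← Real.rpow_natCast, ← Real.rpow_mul ht.le,
      ← Real.rpow_one_add' ht.le (by norm_num), ← Real.rpow_one_add' ht.le (by norm_num)]
    norm_num
  rw [h]
  exact Real.rpow_le_rpow (by positivity) (by linarith) (by norm_num)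

lemma hasDerivAt_neg_two_mul_one_add_sq_rpow (t : ℝ) :
    HasDerivAt (fun t : ℝ => -2 * (1 + t ^ 2) ^ (-(1/4) : ℝ))
      (t / (1 + t ^ 2) ^ ((5:ℝ) / 4)) t := by
  have hp : 0 < 1 + t ^ 2 := by positivity
  have h := (((hasDerivAt_pow 2 t).const_add 1).rpow_const (p := (-(1/4) : ℝ))
    (Or.inl hp.ne')).const_mul (-2)
  refine h.congr_deriv ?_
  rw [show (-(1/4) - 1 : ℝ) = -(5/4) by norm_num, Real.rpow_neg hp.le]
  norm_num
  ring

lemma tendsto_neg_two_mul_one_add_sq_rpow :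
    Tendsto (fun t : ℝ => -2 * (1 + t ^ 2) ^ (-(1/4) : ℝ)) atTop (𝓝 0) := by
  have h : Tendsto (fun t : ℝ => 1 + t ^ 2) atTop atTop :=
    tendsto_atTop_add_const_left _ _ (tendsto_pow_atTop two_ne_zero)
  simpa using ((tendsto_rpow_neg_atTop (by norm_num : (0:ℝ) < 1/4)).comp h).const_mul (-2)

lemma integrableOn_div_one_add_sq_rpow :
    IntegrableOn (fun t : ℝ => t / (1 + t ^ 2) ^ ((5:ℝ) / 4)) (Ioi 0) :=
  integrableOn_Ioi_deriv_of_nonneg'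
    (fun t _ => hasDerivAt_neg_two_mul_one_add_sq_rpow t)
    (fun t ht => div_nonneg (le_of_lt ht) (by positivity)) tendsto_neg_two_mul_one_add_sq_rpow

lemma integral_div_one_add_sq_rpow :
    ∫ t in Ioi (0:ℝ), t / (1 + t ^ 2) ^ ((5:ℝ) / 4) = 2 := by
  rw [integral_Ioi_of_hasDerivAt_of_nonneg'
    (fun t _ => hasDerivAt_neg_two_mul_one_add_sq_rpow t)
    (fun t ht => div_nonneg (le_of_lt ht) (by positivity)) tendsto_neg_two_mul_one_add_sq_rpow]
  norm_num

lemma integrableOn_one_div_one_add_sq_rpow :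
    IntegrableOn (fun t : ℝ => 1 / (1 + t ^ 2) ^ ((5:ℝ) / 4)) (Ioi 0) := by
  have h := integrable_rpow_neg_one_add_norm_sq (E := ℝ) (μ := volume) (r := 5 / 2)
    (by norm_num)
  refine (h.congr (Eventually.of_forall fun t => ?_)).integrableOn
  simp only [Real.norm_eq_abs, sq_abs]
  rw [show (-(5 / 2) / 2 : ℝ) = -(5/4) by norm_num, Real.rpow_neg (by positivity), one_div]

lemma beta_eq_integral_Ioo {a b : ℝ} (ha : 0 < a) (hb : 0 < b) :
    ProbabilityTheory.beta a b = ∫ x in Ioo (0:ℝ) 1, x ^ (a - 1) * (1 - x) ^ (b - 1) := by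
  rw [ProbabilityTheory.beta_eq_betaIntegralReal a b ha hb, Complex.betaIntegral,
    ← integral_Ioc_eq_integral_Ioo, ← intervalIntegral.integral_of_le zero_le_one]
  have : ∀ x ∈ uIcc (0:ℝ) 1, (x:ℂ) ^ ((a:ℂ) - 1) * (1 - (x:ℂ)) ^ ((b:ℂ) - 1) =
      ((x ^ (a - 1) * (1 - x) ^ (b - 1) : ℝ) : ℂ) := by
    intro x hx
    rw [uIcc_of_le zero_le_one] at hx
    push_cast [Complex.ofReal_cpow hx.1, Complex.ofReal_cpow (sub_nonneg.2 hx.2)]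
    rfl
  rw [intervalIntegral.integral_congr this, intervalIntegral.integral_ofReal,
    Complex.ofReal_re]

lemma image_inv_one_add_sq_Ioi : (fun t : ℝ => (1 + t ^ 2)⁻¹) '' Ioi 0 = Ioo 0 1 := by
  ext x
  constructor
  · rintro ⟨t, ht, rfl⟩
    have ht' : 0 < t := ht
    exact ⟨by positivity, inv_lt_one_of_one_lt₀ (by nlinarith)⟩
  · rintro ⟨h0, h1⟩
    have hx : 0 < x⁻¹ - 1 := sub_pos.2 ((one_lt_inv₀ h0).2 h1)
    refine ⟨Real.sqrt (x⁻¹ - 1), Real.sqrt_pos.2 hx, ?_⟩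
    simp only [Real.sq_sqrt hx.le]
    simp

lemma two_mul_integral_one_div_one_add_sq_rpow :
    2 * ∫ t in Ioi (0:ℝ), 1 / (1 + t ^ 2) ^ ((5:ℝ) / 4) =
      ProbabilityTheory.beta (3 / 4) (1 / 2) := by
  rw [beta_eq_integral_Ioo (by norm_num) (by norm_num), ← image_inv_one_add_sq_Ioi,
    integral_image_eq_integral_abs_deriv_smul (f' := fun t => -(2 * t) / (1 + t ^ 2) ^ 2)
      measurableSet_Ioi ?_ ?_, ← integral_const_mul]
  · refine setIntegral_congr_fun measurableSet_Ioi fun t ht => ?_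
    have ht' : 0 < t := ht
    have hp : 0 < 1 + t ^ 2 := by positivity
    have h1 : 1 - (1 + t ^ 2)⁻¹ = t ^ 2 * (1 + t ^ 2)⁻¹ := by field_simp; ring
    have h2 : |-(2 * t) / (1 + t ^ 2) ^ 2| = 2 * t / (1 + t ^ 2) ^ 2 := by
      rw [neg_div, abs_neg, abs_of_pos (by positivity)]
    have h3 : (t ^ 2) ^ (-(1/2) : ℝ) = t⁻¹ := by
      rw [Real.rpow_neg (by positivity), ← Real.sqrt_eq_rpow, Real.sqrt_sq ht'.le]
    have h4 : ((1 + t ^ 2)⁻¹) ^ (-(1/4) : ℝ) * ((1 + t ^ 2)⁻¹) ^ (-(1/2) : ℝ) *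
        (1 + t ^ 2) ^ ((5:ℝ) / 4) = (1 + t ^ 2) ^ 2 := by
      rw [Real.inv_rpow hp.le, Real.inv_rpow hp.le, ← Real.rpow_neg hp.le,
        ← Real.rpow_neg hp.le, ← Real.rpow_add hp, ← Real.rpow_add hp, ← Real.rpow_natCast]
      norm_num
    simp only [smul_eq_mul]
    rw [h1, h2, show (3 / 4 - 1 : ℝ) = -(1/4) by norm_num,
      show (1 / 2 - 1 : ℝ) = -(1/2) by norm_num,
      Real.mul_rpow (by positivity) (by positivity), h3]
    rw [mul_one_div, div_eq_iff (by positivity)]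
    calc (2:ℝ) = 2 * t / (1 + t ^ 2) ^ 2 * (t⁻¹ * (1 + t ^ 2) ^ 2) := by field_simp
      _ = _ := by rw [← h4]; ring
  · intro t _
    have h := (((hasDerivAt_pow 2 t).const_add 1).inv (by positivity)).hasDerivWithinAt
      (s := Ioi 0)
    exact h.congr_deriv (by simp)
  · intro s hs t ht h
    have hs' : 0 < s := hs
    have ht' : 0 < t := ht
    have h' : s ^ 2 = t ^ 2 := by simpa using h
    exact (pow_left_inj₀ hs'.le ht'.le two_ne_zero).1 h'

lemma two_div_beta_eq :
    2 / ProbabilityTheory.beta (3 / 4) (1 / 2) =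
      (1/3) * (Real.Gamma (7/4) * Real.Gamma (1/4)) /
        (Real.Gamma (3/4)^2 * Real.Gamma (3/2)) := by
  have h1 : Real.Gamma (7/4) = 3/4 * Real.Gamma (3/4) := by
    rw [← Real.Gamma_add_one (by norm_num)]; norm_num
  have h2 : Real.Gamma (3/2) = 1/2 * Real.Gamma (1/2) := by
    rw [← Real.Gamma_add_one (by norm_num)]; norm_num
  have h3 : Real.Gamma (5/4) = 1/4 * Real.Gamma (1/4) := by
    rw [← Real.Gamma_add_one (by norm_num)]; norm_num
  have p1 : 0 < Real.Gamma (3/4) := Real.Gamma_pos_of_pos (by norm_num)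
  have p2 : 0 < Real.Gamma (1/2) := Real.Gamma_pos_of_pos (by norm_num)
  have p3 : 0 < Real.Gamma (1/4) := Real.Gamma_pos_of_pos (by norm_num)
  rw [ProbabilityTheory.beta, show (3 / 4 + 1 / 2 : ℝ) = 5 / 4 by norm_num, h1, h2, h3]
  field_simp

lemma continuous_one_div_one_add_sq_rpow :
    Continuous fun t : ℝ => 1 / (1 + t ^ 2) ^ ((5:ℝ) / 4) :=
  continuous_const.div (continuous_one_add_sq_rpow _) fun t => by positivity

lemma continuous_div_one_add_sq_rpow :
    Continuous fun t : ℝ => t / (1 + t ^ 2) ^ ((5:ℝ) / 4) :=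
  continuous_id.div (continuous_one_add_sq_rpow _) fun t => by positivity

lemma ratio_eq (A : ℝ) :
    ratio A = (∫ t in (0:ℝ)..A, t / (1 + t ^ 2) ^ ((5:ℝ) / 4) / Real.sqrt (A - t)) /
      (2 * ∫ t in (0:ℝ)..A, 1 / (1 + t ^ 2) ^ ((5:ℝ) / 4) / Real.sqrt (A - t)) := by
  simp only [ratio, div_div, mul_comm]

lemma ratio_le_half {A : ℝ} (hA : 0 < A) : ratio A ≤ A / 2 := by
  have hD : 0 ≤ ∫ t in (0:ℝ)..A, 1 / (1 + t ^ 2) ^ ((5:ℝ) / 4) / Real.sqrt (A - t) :=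
    intervalIntegral.integral_nonneg hA.le fun t _ => by positivity
  have hN : ∫ t in (0:ℝ)..A, t / (1 + t ^ 2) ^ ((5:ℝ) / 4) / Real.sqrt (A - t) ≤
      A * ∫ t in (0:ℝ)..A, 1 / (1 + t ^ 2) ^ ((5:ℝ) / 4) / Real.sqrt (A - t) := by
    rw [← intervalIntegral.integral_const_mul]
    refine intervalIntegral.integral_mono_on hA.le
      (intervalIntegrable_div_sqrt_sub continuous_div_one_add_sq_rpow A _ _ hA.le le_rfl)
      ((intervalIntegrable_div_sqrt_sub continuous_one_div_one_add_sq_rpow A _ _ hA.le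
        le_rfl).const_mul A) fun t ht => ?_
    rw [mul_div_assoc', mul_one_div]
    have := ht.2
    gcongr
  rw [ratio_eq]
  exact div_le_of_le_mul₀ (by positivity) (by positivity) (by linarith)

lemma tendsto_ratio_atTop :
    Tendsto ratio atTop (𝓝 ((1/3) * (Real.Gamma (7/4) * Real.Gamma (1/4)) /
      (Real.Gamma (3/4)^2 * Real.Gamma (3/2)))) := by
  have hN := tendsto_sqrt_mul_integral_div_sqrt_sub continuous_div_one_add_sq_rpow
    integrableOn_div_one_add_sq_rpow fun t ht => by
      rw [abs_of_pos (by positivity), div_mul_eq_mul_div, div_le_one (by positivity)]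
      exact mul_mul_sqrt_le_one_add_sq_rpow ht
  have hD := (tendsto_sqrt_mul_integral_div_sqrt_sub continuous_one_div_one_add_sq_rpow
    integrableOn_one_div_one_add_sq_rpow fun t ht => by
      rw [abs_of_pos (by positivity), div_mul_eq_mul_div, div_le_one (by positivity), one_mul]
      exact mul_sqrt_le_one_add_sq_rpow ht).const_mul 2
  rw [two_mul_integral_one_div_one_add_sq_rpow] at hD
  rw [integral_div_one_add_sq_rpow] at hN
  rw [← two_div_beta_eq]
  refine (hN.div hD (ProbabilityTheory.beta_pos (by norm_num) (by norm_num)).ne').congr' ?_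
  filter_upwards [eventually_gt_atTop 0] with A hA
  rw [ratio_eq, Pi.div_apply, mul_left_comm, mul_div_mul_left _ _ (Real.sqrt_pos.2 hA).ne']

lemma bddAbove_ratio_image : BddAbove (ratio '' Ioi 0) := by
  obtain ⟨M, hM⟩ := tendsto_ratio_atTop.isBoundedUnder_le
  obtain ⟨A₀, h⟩ := eventually_atTop.1 (eventually_map.1 hM)
  refine ⟨max (A₀ / 2) M, forall_mem_image.2 fun A hA => ?_⟩
  rcases le_total A₀ A with hle | hle
  · exact (h A hle).trans (le_max_right _ _)
  · exact (ratio_le_half hA).trans ((by linarith : A / 2 ≤ A₀ / 2).trans (le_max_left _ _))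

/-- `R(A) ≤ A/2`, `R(A)` converges as `A → ∞` to the stated Gamma-quotient,
and `sup_{A>0} R(A)` is finite. -/
theorem stmt19 :
    (∀ A : ℝ, 0 < A → ratio A ≤ A / 2) ∧
    Tendsto ratio atTop (𝓝 ((1/3) * (Real.Gamma (7/4) * Real.Gamma (1/4)) /
      (Real.Gamma (3/4)^2 * Real.Gamma (3/2)))) ∧
    BddAbove (ratio '' Ioi 0) := by
  exact ⟨fun _ hA => ratio_le_half hA, tendsto_ratio_atTop, bddAbove_ratio_image⟩
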